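/- arXiv:2605.16963 — 3 statements merged into one kernel-verified Lean document; each statement's English description precedes it below -/
import Mathlib

section
/- Let P, L, G be bounded linear operators on H. Set A := L + G, L_sym := L + L*, R₁ := [L, L_sym], R₂ := [G, L], R₃ := [P, L], and R₄ := [R₃, L]. Then for every f ∈ H the following identity holds: ⟨P A² f, P f⟩ + ⟨P A f, P A f⟩ = ⟨R₄ f, P f⟩ + ⟨R₃ f, R₃ f⟩ + 2⟨P f, L_sym (R₃ f)⟩ − (1/2)⟨P f, R₁ (P f)⟩ + (1/2)⟨P f, L_sym² (P f)⟩ + 2⟨P G f, R₃ f⟩ + 2⟨P G f, L_sym (P f)⟩ + 2⟨R₃ G f, P f⟩ + ⟨P R₂ f, P f⟩ + ⟨P G² f, P f⟩ + ⟨P G f, P G f⟩. -/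
open scoped RealInnerProductSpace

/-- Let `P, L, G` be bounded linear operators on a real Hilbert space `H`.
Set `A := L + G`, `L_sym := L + L*`, `R₁ := [L, L_sym]`, `R₂ := [G, L]`, `R₃ := [P, L]`,
`R₄ := [R₃, L]`. Then for every `f ∈ H`:
`⟨P A² f, P f⟩ + ⟨P A f, P A f⟩ = ⟨R₄ f, P f⟩ + ⟨R₃ f, R₃ f⟩ + 2⟨P f, L_sym (R₃ f)⟩
  − (1/2)⟨P f, R₁ (P f)⟩ + (1/2)⟨P f, L_sym² (P f)⟩ + 2⟨P G f, R₃ f⟩ + 2⟨P G f, L_sym (P f)⟩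
  + 2⟨R₃ G f, P f⟩ + ⟨P R₂ f, P f⟩ + ⟨P G² f, P f⟩ + ⟨P G f, P G f⟩`. -/
theorem stmt9 {H : Type*} [NormedAddCommGroup H] [InnerProductSpace ℝ H] [CompleteSpace H]
    (P L G A Lsym R₁ R₂ R₃ R₄ : H →L[ℝ] H)
    (hA : A = L + G)
    (hLsym : Lsym = L + ContinuousLinearMap.adjoint L)
    (hR₁ : R₁ = L ∘L Lsym - Lsym ∘L L)
    (hR₂ : R₂ = G ∘L L - L ∘L G)
    (hR₃ : R₃ = P ∘L L - L ∘L P)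
    (hR₄ : R₄ = R₃ ∘L L - L ∘L R₃)
    (f : H) :
    ⟪P (A (A f)), P f⟫ + ⟪P (A f), P (A f)⟫ =
      ⟪R₄ f, P f⟫ + ⟪R₃ f, R₃ f⟫ + 2 * ⟪P f, Lsym (R₃ f)⟫
        - (1 / 2 : ℝ) * ⟪P f, R₁ (P f)⟫ + (1 / 2 : ℝ) * ⟪P f, Lsym (Lsym (P f))⟫
        + 2 * ⟪P (G f), R₃ f⟫ + 2 * ⟪P (G f), Lsym (P f)⟫
        + 2 * ⟪R₃ (G f), P f⟫ + ⟪P (R₂ f), P f⟫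
        + ⟪P (G (G f)), P f⟫ + ⟪P (G f), P (G f)⟫ := by
  subst hA hLsym hR₁ hR₄ hR₃ hR₂
  simp only [add_apply, sub_apply,
    ContinuousLinearMap.comp_apply, map_add, map_sub, inner_add_left, inner_add_right,
    inner_sub_left, inner_sub_right, ContinuousLinearMap.adjoint_inner_right]
  simp only [real_inner_comm]
  linarith
end

section
/- Under the context hypotheses, if in addition a₀ > 0, then for all (t,x) ∈ [0,T*) × ℝ^d: a₀ · exp(−C ∫₀ᵗ D(t') dt') ≤ f(t,x) ≤ b₀ · exp(C ∫₀ᵗ D(t') dt'). -/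
open MeasureTheory
open scoped ENNReal BigOperators

/-- The (spatial) divergence of a vector field `w : ℝ^d → ℝ^d`:
`div w (x) = ∑ i ∂_{x_i} w_i (x)`. -/
noncomputable def divg {d : ℕ} (w : EuclideanSpace ℝ (Fin d) → EuclideanSpace ℝ (Fin d))
    (x : EuclideanSpace ℝ (Fin d)) : ℝ :=
  ∑ i : Fin d, fderiv ℝ w x (EuclideanSpace.single i 1) i

/-- Two-sided Grönwall estimate for a positive function with an integrable logarithmic rate. -/
lemma mul_exp_bounds_of_abs_deriv_le {u u' K : ℝ → ℝ} {t : ℝ} (ht : 0 ≤ t)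
    (hu : ∀ s ∈ Set.Icc 0 t, HasDerivWithinAt u (u' s) (Set.Icc 0 t) s)
    (hpos : ∀ s ∈ Set.Icc 0 t, 0 < u s) (hK : IntegrableOn K (Set.Icc 0 t))
    (hbound : ∀ s ∈ Set.Icc 0 t, |u' s| ≤ K s * u s) :
    u 0 * Real.exp (-∫ s in (0:ℝ)..t, K s) ≤ u t ∧
      u t ≤ u 0 * Real.exp (∫ s in (0:ℝ)..t, K s) := by
  have hlog : ∀ s ∈ Set.Icc 0 t,
      HasDerivWithinAt (fun s => Real.log (u s)) (u' s / u s) (Set.Icc 0 t) s :=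
    fun s hs => (hu s hs).log (hpos s hs).ne'
  have hcont : ContinuousOn (fun s => Real.log (u s)) (Set.Icc 0 t) :=
    fun s hs => (hlog s hs).continuousWithinAt
  have hright : ∀ s ∈ Set.Ioo 0 t,
      HasDerivWithinAt (fun s => Real.log (u s)) (u' s / u s) (Set.Ioi s) s := fun s hs =>
    ((hlog s (Set.Ioo_subset_Icc_self hs)).hasDerivAt
      (Icc_mem_nhds hs.1 hs.2)).hasDerivWithinAt
  have hrate : ∀ s ∈ Set.Ioo 0 t, |u' s / u s| ≤ K s := fun s hs => by
    have hs' := Set.Ioo_subset_Icc_self hs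
    rw [abs_div, abs_of_pos (hpos s hs'), div_le_iff₀ (hpos s hs')]
    exact hbound s hs'
  have hupper := intervalIntegral.sub_le_integral_of_hasDeriv_right_of_le ht hcont hright hK
    (fun s hs => (abs_le.1 (hrate s hs)).2)
  have hlower := intervalIntegral.sub_le_integral_of_hasDeriv_right_of_le ht hcont.neg
    (fun s hs => (hright s hs).neg) hK (fun s hs => neg_le.1 (abs_le.1 (hrate s hs)).1)
  simp only [Pi.neg_apply] at hlower
  have h0 := hpos 0 (Set.left_mem_Icc.2 ht)
  have h1 := hpos t (Set.right_mem_Icc.2 ht)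
  constructor
  · rw [← Real.log_le_log_iff (by positivity) h1, Real.log_mul h0.ne' (Real.exp_ne_zero _),
      Real.log_exp]
    linarith
  · rw [← Real.log_le_log_iff h1 (by positivity), Real.log_mul h0.ne' (Real.exp_ne_zero _),
      Real.log_exp]
    linarith

/-- A function whose derivative is bounded by an integrable multiple of its absolute value
has no zero if it starts from a positive value. -/
lemma pos_of_abs_deriv_le_mul_abs {g g' K : ℝ → ℝ} {t : ℝ}
    (hg : ∀ s ∈ Set.Icc 0 t, HasDerivWithinAt g (g' s) (Set.Icc 0 t) s)
    (hK : IntegrableOn K (Set.Icc 0 t)) (hbound : ∀ s ∈ Set.Icc 0 t, |g' s| ≤ K s * |g s|)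
    (hK0 : ∀ s ∈ Set.Icc 0 t, 0 ≤ K s) (h0 : 0 < g 0) :
    ∀ s ∈ Set.Icc 0 t, 0 < g s := by
  have hne : ∀ r ∈ Set.Icc 0 t, g r ≠ 0 := by
    intro r hr hzero
    have hsub : Set.Icc 0 r ⊆ Set.Icc 0 t := Set.Icc_subset_Icc_right hr.2
    have hsq : ∀ ε > 0, g 0 ^ 2 * Real.exp (-∫ s in (0:ℝ)..r, 2 * K s) ≤ g r ^ 2 + ε := by
      intro ε hε
      have key := (mul_exp_bounds_of_abs_deriv_le (u := fun s => g s ^ 2 + ε)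
        (u' := fun s => 2 * g s * g' s) (K := fun s => 2 * K s) hr.1
        (fun s hs => by
          simpa using (((hg s (hsub hs)).mono hsub).pow 2).add_const ε)
        (fun s _ => by positivity) ((hK.mono_set hsub).const_mul 2)
        (fun s hs => by
          rw [abs_mul, abs_mul, abs_two]
          have hb := mul_le_mul_of_nonneg_left (hbound s (hsub hs)) (abs_nonneg (g s))
          nlinarith [hb, sq_abs (g s), mul_nonneg (hK0 s (hsub hs)) hε.le])).1
      refine le_trans ?_ key
      gcongr
      linarith
    have hle := le_of_forall_pos_le_add hsq
    have : 0 < g 0 ^ 2 * Real.exp (-∫ s in (0:ℝ)..r, 2 * K s) := by positivity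
    simp only [hzero] at hle
    linarith
  intro s hs
  by_contra! hneg
  have hsub : Set.Icc 0 s ⊆ Set.Icc 0 t := Set.Icc_subset_Icc_right hs.2
  have hcont : ContinuousOn g (Set.Icc 0 s) :=
    fun r hr => ((hg r (hsub hr)).mono hsub).continuousWithinAt
  obtain ⟨r, hr, hzero⟩ := intermediate_value_Icc' hs.1 hcont ⟨hneg, h0.le⟩
  exact hne r (hsub hr) hzero

/-- Chain rule for a function of time and space along a curve, in terms of its partial
derivatives. -/
lemma hasDerivWithinAt_along_curve {E : Type*} [NormedAddCommGroup E] [NormedSpace ℝ E]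
    {f : ℝ → E → ℝ} {S : Set ℝ} {γ : ℝ → E} {s p : ℝ} {w : E}
    (hS : UniqueDiffWithinAt ℝ S s) (hs : s ∈ S)
    (hf : DifferentiableWithinAt ℝ (Function.uncurry f) (S ×ˢ Set.univ) (s, γ s))
    (hft : HasDerivWithinAt (fun r => f r (γ s)) p S s)
    (hγ : HasDerivWithinAt γ w S s) :
    HasDerivWithinAt (fun r => f r (γ r)) (p + fderiv ℝ (f s) (γ s) w) S s := by
  obtain ⟨F, hF⟩ := hf
  have htime : HasDerivWithinAt (fun r => f r (γ s)) (F (1, 0)) S s :=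
    HasFDerivWithinAt.comp_hasDerivWithinAt (l := Function.uncurry f) (f := fun r => (r, γ s)) s hF
      ((hasDerivWithinAt_id s S).prodMk (hasDerivWithinAt_const s S (γ s)))
      (fun r hr => Set.mk_mem_prod hr (Set.mem_univ _))
  have hspace : HasFDerivAt (f s) (F.comp (ContinuousLinearMap.inr ℝ ℝ E)) (γ s) := by
    rw [← hasFDerivWithinAt_univ]
    exact HasFDerivWithinAt.comp (γ s) (f := fun y => (s, y)) hF
      (hasFDerivAt_prodMk_right s (γ s)).hasFDerivWithinAt (fun y hy => ⟨hs, hy⟩)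
  have hcurve : HasDerivWithinAt (fun r => f r (γ r)) (F (1, w)) S s :=
    HasFDerivWithinAt.comp_hasDerivWithinAt (l := Function.uncurry f) (f := fun r => (r, γ r)) s hF
      ((hasDerivWithinAt_id s S).prodMk hγ)
      (fun r hr => Set.mk_mem_prod hr (Set.mem_univ _))
  have hp : p = F (1, 0) := hS.eq_deriv _ hft htime
  convert hcurve using 1
  rw [hspace.fderiv, hp, ContinuousLinearMap.comp_apply, ContinuousLinearMap.inr_apply, ← map_add]
  simp

/-- (Maximum principle for a transport equation, positive case.)
Let `d ≥ 2`, `T* ∈ (0,∞]`, `C > 0`, `a₀ < b₀` and let `ϑ : ℝ → ℝ` satisfy `|ϑ(x)| ≤ C|x|`.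
Let `v` be a continuous time-dependent vector field on `[0,T*) × ℝ^d`, `C¹` and Lipschitz in
space, with divergence bounded by a locally integrable function `D ≥ 0`, and let `χ` be a
surjective flow map for `v`.  Let `f` be continuously differentiable and solve the transport
equation `∂_t f + ϑ(f)·div v + v·∇f = 0` with `a₀ ≤ f(0,·) ≤ b₀`.  If `a₀ > 0`, then for all
`(t,x) ∈ [0,T*) × ℝ^d`:
`a₀ · exp(−C ∫₀ᵗ D) ≤ f(t,x) ≤ b₀ · exp(C ∫₀ᵗ D)`. -/
theorem stmt16 {d : ℕ} (hd : 2 ≤ d) (T : ℝ≥0∞) (hT : 0 < T)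
    (C a₀ b₀ : ℝ) (hC : 0 < C) (hab : a₀ < b₀)
    (ϑ : ℝ → ℝ) (hϑ : ∀ x : ℝ, |ϑ x| ≤ C * |x|)
    (v : ℝ → EuclideanSpace ℝ (Fin d) → EuclideanSpace ℝ (Fin d))
    (L D : ℝ → ℝ)
    (hv_cont : ContinuousOn (Function.uncurry v)
      (({s : ℝ | 0 ≤ s ∧ ENNReal.ofReal s < T}) ×ˢ
        (Set.univ : Set (EuclideanSpace ℝ (Fin d)))))
    (hv_smooth : ∀ t : ℝ, 0 ≤ t → ENNReal.ofReal t < T → ContDiff ℝ 1 (v t))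
    (hv_lip : ∀ t : ℝ, 0 ≤ t → ENNReal.ofReal t < T →
      LipschitzWith (Real.toNNReal (L t)) (v t))
    (hD_bound : ∀ t : ℝ, 0 ≤ t → ENNReal.ofReal t < T → ∀ x, |divg (v t) x| ≤ D t)
    (hD0 : ∀ t : ℝ, 0 ≤ t → ENNReal.ofReal t < T → 0 ≤ D t)
    (hLint : ∀ t : ℝ, 0 ≤ t → ENNReal.ofReal t < T → IntegrableOn L (Set.Icc 0 t))
    (hDint : ∀ t : ℝ, 0 ≤ t → ENNReal.ofReal t < T → IntegrableOn D (Set.Icc 0 t))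
    (χ : ℝ → EuclideanSpace ℝ (Fin d) → EuclideanSpace ℝ (Fin d))
    (hχcont : ∀ x, ContinuousOn (fun s => χ s x) {s : ℝ | 0 ≤ s ∧ ENNReal.ofReal s < T})
    (hχ0 : ∀ x, χ 0 x = x)
    (hχ : ∀ x, ∀ t : ℝ, 0 ≤ t → ENNReal.ofReal t < T →
      HasDerivWithinAt (fun s => χ s x) (v t (χ t x)) (Set.Ici 0) t)
    (hχsurj : ∀ t : ℝ, 0 ≤ t → ENNReal.ofReal t < T → Function.Surjective (χ t))
    (f : ℝ → EuclideanSpace ℝ (Fin d) → ℝ)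
    (hf_smooth : ContDiffOn ℝ 1 (Function.uncurry f)
      (({s : ℝ | 0 ≤ s ∧ ENNReal.ofReal s < T}) ×ˢ
        (Set.univ : Set (EuclideanSpace ℝ (Fin d)))))
    (hf_pde : ∀ x, ∀ t : ℝ, 0 ≤ t → ENNReal.ofReal t < T →
      HasDerivWithinAt (fun s => f s x)
        (-(ϑ (f t x) * divg (v t) x + fderiv ℝ (f t) x (v t x))) (Set.Ici 0) t)
    (hf_init : ∀ x, a₀ ≤ f 0 x ∧ f 0 x ≤ b₀)
    (ha₀ : 0 < a₀)
    (t : ℝ) (ht0 : 0 ≤ t) (htT : ENNReal.ofReal t < T)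
    (x : EuclideanSpace ℝ (Fin d)) :
    a₀ * Real.exp (-(C * ∫ s in (0:ℝ)..t, D s)) ≤ f t x ∧
      f t x ≤ b₀ * Real.exp (C * ∫ s in (0:ℝ)..t, D s) := by
  obtain ⟨y, rfl⟩ := hχsurj t ht0 htT x
  rcases ht0.eq_or_lt with rfl | htpos
  · simpa [hχ0] using hf_init y
  have hlt : ∀ s ∈ Set.Icc 0 t, ENNReal.ofReal s < T := fun s hs =>
    (ENNReal.ofReal_le_ofReal hs.2).trans_lt htT
  have hg : ∀ s ∈ Set.Icc 0 t, HasDerivWithinAt (fun r => f r (χ r y))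
      (-(ϑ (f s (χ s y)) * divg (v s) (χ s y))) (Set.Icc 0 t) s := by
    intro s hs
    have hdiff := ((hf_smooth.differentiableOn one_ne_zero) (s, χ s y)
      ⟨⟨hs.1, hlt s hs⟩, Set.mem_univ _⟩).mono
      (Set.prod_mono_left (s₁ := Set.Icc 0 t) fun r hr => ⟨hr.1, hlt r hr⟩)
    convert hasDerivWithinAt_along_curve (uniqueDiffOn_Icc htpos s hs) hs hdiff
      ((hf_pde (χ s y) s hs.1 (hlt s hs)).mono Set.Icc_subset_Ici_self)
      ((hχ y s hs.1 (hlt s hs)).mono Set.Icc_subset_Ici_self) using 1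
    ring
  have hbound : ∀ s ∈ Set.Icc 0 t, |-(ϑ (f s (χ s y)) * divg (v s) (χ s y))| ≤
      C * D s * |f s (χ s y)| := by
    intro s hs
    rw [abs_neg, abs_mul]
    calc |ϑ (f s (χ s y))| * |divg (v s) (χ s y)|
        ≤ C * |f s (χ s y)| * D s :=
          mul_le_mul (hϑ _) (hD_bound s hs.1 (hlt s hs) _) (abs_nonneg _) (by positivity)
      _ = C * D s * |f s (χ s y)| := by ring
  have hK : IntegrableOn (fun s => C * D s) (Set.Icc 0 t) := (hDint t ht0 htT).const_mul C
  have hinit := hf_init y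
  have hpos := pos_of_abs_deriv_le_mul_abs hg hK hbound
    (fun s hs => mul_nonneg hC.le (hD0 s hs.1 (hlt s hs)))
    (by simpa only [hχ0] using ha₀.trans_le hinit.1)
  have key := mul_exp_bounds_of_abs_deriv_le ht0 hg hpos hK
    (fun s hs => by simpa only [abs_of_pos (hpos s hs)] using hbound s hs)
  simp only [hχ0, intervalIntegral.integral_const_mul] at key
  exact ⟨(mul_le_mul_of_nonneg_right hinit.1 (Real.exp_pos _).le).trans key.1,
    key.2.trans (mul_le_mul_of_nonneg_right hinit.2 (Real.exp_pos _).le)⟩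
end

section
/- Suppose that for almost every t ≥ 0 one has f₁'(t) ≤ −q(t) · f₂(t) and f₂(t) ≤ f₁(t). Then for every t ≥ 0: ∫₀ᵗ q(t') f₂(t') dt' ≤ f₁(0) · (1 − exp(−∫₀ᵗ q(t') dt')). -/
open MeasureTheory

/-- A function that is Lipschitz on the range of an absolutely continuous function may be
composed with it. -/
theorem LipschitzOnWith.comp_absolutelyContinuousOnInterval {g f : ℝ → ℝ} {K : NNReal}
    {s : Set ℝ} {a b : ℝ} (hg : LipschitzOnWith K g s)
    (hf : AbsolutelyContinuousOnInterval f a b) (hs : Set.MapsTo f (Set.uIcc a b) s) :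
    AbsolutelyContinuousOnInterval (fun x ↦ g (f x)) a b := by
  unfold AbsolutelyContinuousOnInterval at hf ⊢
  refine squeeze_zero' (.of_forall fun _ ↦ Finset.sum_nonneg fun _ _ ↦ dist_nonneg) ?_
    (by simpa using hf.const_mul (K : ℝ))
  rw [Filter.eventually_inf_principal]
  filter_upwards with E hE
  rw [Finset.mul_sum]
  exact Finset.sum_le_sum fun i hi ↦
    hg.dist_le_mul _ (hs (hE.1 i hi).1) _ (hs (hE.1 i hi).2)

theorem AbsolutelyContinuousOnInterval.exp {f : ℝ → ℝ} {a b : ℝ}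
    (hf : AbsolutelyContinuousOnInterval f a b) :
    AbsolutelyContinuousOnInterval (fun x ↦ Real.exp (f x)) a b := by
  obtain ⟨C, hC⟩ := hf.exists_bound
  obtain ⟨K, hK⟩ := Real.contDiff_exp.contDiffOn.exists_lipschitzOnWith one_ne_zero
    (convex_Icc (-C) C) isCompact_Icc
  exact hK.comp_absolutelyContinuousOnInterval hf fun x hx ↦ abs_le.1 (hC x hx)

/-- An absolutely continuous function whose derivative is almost everywhere nonnegative does not
decrease. -/
theorem AbsolutelyContinuousOnInterval.le_of_ae_hasDerivAt_nonneg {f f' : ℝ → ℝ} {a b : ℝ}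
    (hab : a ≤ b) (hf : AbsolutelyContinuousOnInterval f a b)
    (hf' : ∀ᵐ x, x ∈ Set.Icc a b → HasDerivAt f (f' x) x ∧ 0 ≤ f' x) : f a ≤ f b := by
  rw [← sub_nonneg, ← hf.integral_deriv_eq_sub]
  refine intervalIntegral.integral_nonneg_of_ae_restrict hab ?_
  rw [Filter.EventuallyLE, ae_restrict_iff' measurableSet_Icc]
  filter_upwards [hf'] with x hx hxab
  exact (hx hxab).1.deriv ▸ (hx hxab).2

/-- The integral form of Grönwall's inequality with an integrable coefficient: if `p` is at most
`q` times `C - ∫ p`, then `C - ∫ p` decays no faster than `C * exp (-∫ q)`. -/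
theorem intervalIntegral_le_mul_one_sub_exp {p q : ℝ → ℝ} {C a b : ℝ} (hab : a ≤ b)
    (hp : IntervalIntegrable p volume a b) (hq : IntervalIntegrable q volume a b)
    (h : ∀ᵐ x, x ∈ Set.Icc a b → p x ≤ q x * (C - ∫ s in a..x, p s)) :
    ∫ s in a..b, p s ≤ C * (1 - Real.exp (-∫ s in a..b, q s)) := by
  have ha : a ∈ Set.uIcc a b := Set.left_mem_uIcc
  have hE := (hq.absolutelyContinuousOnInterval_intervalIntegral ha).exp
  have hconst : AbsolutelyContinuousOnInterval (fun _ ↦ C) a b :=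
    (contDiff_const (n := 1)).contDiffOn.absolutelyContinuousOnInterval
  have hH := hconst.fun_sub (hp.absolutelyContinuousOnInterval_intervalIntegral ha)
  have key := (hH.fun_mul hE).le_of_ae_hasDerivAt_nonneg hab
    (f' := fun x ↦ -p x * Real.exp (∫ s in a..x, q s)
      + (C - ∫ s in a..x, p s) * (Real.exp (∫ s in a..x, q s) * q x)) (by
    filter_upwards [hp.ae_hasDerivAt_integral, hq.ae_hasDerivAt_integral, h] with x hpx hqx hx hxab
    have hxab' : x ∈ Set.uIcc a b := Set.Icc_subset_uIcc hxab
    refine ⟨((hpx hxab' a ha).const_sub C).mul (hqx hxab' a ha).exp, ?_⟩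
    have := mul_nonneg (sub_nonneg.2 (hx hxab)) (Real.exp_pos (∫ s in a..x, q s)).le
    linarith)
  simp only [intervalIntegral.integral_same, Real.exp_zero, sub_zero, mul_one] at key
  have := mul_le_mul_of_nonneg_right key (Real.exp_pos (-∫ s in a..b, q s)).le
  rw [mul_assoc, ← Real.exp_add, add_neg_cancel, Real.exp_zero, mul_one] at this
  linarith

/-- (A Grönwall-type lemma.)  Let `f₁ : [0,∞) → [0,∞)` be locally
absolutely continuous, with a locally integrable a.e.-derivative `f₁'` satisfying the
fundamental theorem of calculus, let `f₂ : [0,∞) → [0,∞)` be measurable and locally bounded,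
and let `q : [0,∞) → [0,∞)` be measurable and locally integrable.  Suppose that for almost
every `t ≥ 0` one has `f₁'(t) ≤ −q(t) · f₂(t)` and `f₂(t) ≤ f₁(t)`.  Then for every `t ≥ 0`:
`∫₀ᵗ q f₂ ≤ f₁(0) · (1 − exp(−∫₀ᵗ q))`. -/
theorem stmt18 (f₁ f₂ q f₁' : ℝ → ℝ)
    (hf₁_nonneg : ∀ t : ℝ, 0 ≤ t → 0 ≤ f₁ t)
    (hf₁'_int : ∀ T : ℝ, 0 ≤ T → IntegrableOn f₁' (Set.Icc 0 T))
    (hf₁_fund : ∀ t : ℝ, 0 ≤ t → f₁ t = f₁ 0 + ∫ s in (0:ℝ)..t, f₁' s)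
    (hf₁_deriv : ∀ᵐ t ∂(volume.restrict (Set.Ici (0:ℝ))), HasDerivAt f₁ (f₁' t) t)
    (hf₂_nonneg : ∀ t : ℝ, 0 ≤ t → 0 ≤ f₂ t)
    (hf₂_meas : Measurable f₂)
    (hf₂_bdd : ∀ T : ℝ, 0 ≤ T → ∃ M : ℝ, ∀ s ∈ Set.Icc (0:ℝ) T, f₂ s ≤ M)
    (hq_nonneg : ∀ t : ℝ, 0 ≤ t → 0 ≤ q t)
    (hq_meas : Measurable q)
    (hq_int : ∀ T : ℝ, 0 ≤ T → IntegrableOn q (Set.Icc 0 T))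
    (hmain : ∀ᵐ t ∂(volume.restrict (Set.Ici (0:ℝ))),
      f₁' t ≤ -(q t * f₂ t) ∧ f₂ t ≤ f₁ t)
    (t : ℝ) (ht : 0 ≤ t) :
    ∫ s in (0:ℝ)..t, q s * f₂ s ≤ f₁ 0 * (1 - Real.exp (-∫ s in (0:ℝ)..t, q s)) := by
  have hq : IntegrableOn q (Set.Icc 0 t) := hq_int t ht
  have hqf : IntegrableOn (fun s ↦ q s * f₂ s) (Set.Icc 0 t) := by
    obtain ⟨M, hM⟩ := hf₂_bdd t ht
    refine hq.mul_bdd (c := M) hf₂_meas.aestronglyMeasurable ?_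
    filter_upwards [ae_restrict_mem measurableSet_Icc] with s hs
    rw [Real.norm_of_nonneg (hf₂_nonneg s hs.1)]
    exact hM s hs
  rw [ae_restrict_iff' measurableSet_Ici] at hmain
  have hle : ∀ x ∈ Set.Icc 0 t, f₁ x ≤ f₁ 0 - ∫ s in (0 : ℝ)..x, q s * f₂ s := by
    intro x hx
    have hint : IntervalIntegrable (fun s ↦ q s * f₂ s) volume 0 x :=
      (intervalIntegrable_iff_integrableOn_Icc_of_le hx.1).2
        (hqf.mono_set (Set.Icc_subset_Icc_right hx.2))
    rw [hf₁_fund x hx.1, sub_eq_add_neg, ← intervalIntegral.integral_neg]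
    gcongr
    refine intervalIntegral.integral_mono_ae_restrict hx.1
      ((intervalIntegrable_iff_integrableOn_Icc_of_le hx.1).2 (hf₁'_int x hx.1)) hint.neg ?_
    rw [Filter.EventuallyLE, ae_restrict_iff' measurableSet_Icc]
    filter_upwards [hmain] with s hs hsx
    exact (hs hsx.1).1
  refine intervalIntegral_le_mul_one_sub_exp ht
    ((intervalIntegrable_iff_integrableOn_Icc_of_le ht).2 hqf)
    ((intervalIntegrable_iff_integrableOn_Icc_of_le ht).2 hq) ?_
  filter_upwards [hmain] with x hx hxt
  exact mul_le_mul_of_nonneg_left ((hx hxt.1).2.trans (hle x hxt)) (hq_nonneg x hxt.1)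
end
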